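/- arXiv:1711.08797 — 3 statements merged into one kernel-verified Lean document; each statement's English description precedes it below -/
import Mathlib

section
/- Let d and d' be positive integers, let v ∈ ℝ^d with ‖v‖₂ = 1, and let h : [d] → [d'] and sgn : [d] → {−1,+1} be independent uniformly random functions (the values h(1),…,h(d), sgn(1),…,sgn(d) are mutually independent, h(j) uniform on [d'] and sgn(j) uniform on {−1,+1}). Define v' ∈ ℝ^{d'} by v'_i = Σ_{j : h(j) = i} sgn(j)·v_j. Let ε, δ ∈ (0,1), set α = 16·ε^{−2}·log₂(1/δ) and β = √(ε·log(1 + 4/ε)) / (6·√(log(1/δ)·log(d'/δ))). If d' ≥ α and ‖v‖_∞ ≤ β, then Pr[1 − ε < ‖v'‖₂² < 1 + ε] ≥ 1 − 4δ. -/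
open MeasureTheory ProbabilityTheory Real Finset

noncomputable section

/-- Sample space for the random hash functions `h : [d] → [d']` and `sgn : [d] → {-1,+1}`. -/
abbrev HashOmega (d d' : ℕ) : Type := (Fin d → Fin d') × (Fin d → Bool)

/-- The uniform probability measure on `HashOmega d d'`; this encodes that all values
`h(j)`, `sgn(j)` are mutually independent and uniformly distributed. -/
noncomputable def hashUnif (d d' : ℕ) [NeZero d'] : Measure (HashOmega d d') :=
  (PMF.uniformOfFintype (HashOmega d d')).toMeasure

/-- The sign `sgn(j) ∈ {-1,+1}` of coordinate `j` at sample point `ω`. -/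
def hashSgn {d d' : ℕ} (ω : HashOmega d d') (j : Fin d) : ℝ :=
  if ω.2 j then 1 else -1

/-- The prefix vector `v'^{(k)} ∈ ℝ^{d'}`: feature hashing applied to the first `k`
coordinates of `v`, i.e. `v'^{(k)}_i = ∑_{j ≤ k, h(j) = i} sgn(j)·v_j`.
For `k = d` this is the feature-hashed vector `v'` itself. -/
def prefixVec {d : ℕ} (d' : ℕ) (v : Fin d → ℝ) (k : ℕ) (ω : HashOmega d d') :
    Fin d' → ℝ :=
  fun i => ∑ j ∈ univ.filter (fun j : Fin d => (j : ℕ) < k ∧ ω.1 j = i),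
    hashSgn ω j * v j

/-- Squared euclidean norm of a vector in `ℝ^n`. -/
def sqNorm {n : ℕ} (w : Fin n → ℝ) : ℝ := ∑ i, (w i) ^ 2

/-- `(cosh x - 1) / x ^ 2` is monotone in `|x|`. -/
lemma cosh_mul_sub_one_le {t : ℝ} (ht : |t| ≤ 1) (x : ℝ) :
    cosh (t * x) - 1 ≤ t ^ 2 * (cosh x - 1) := by
  have hconv : ConvexOn ℝ (Set.Ici 0) sinh := by
    apply convexOn_of_deriv2_nonneg (convex_Ici 0) continuous_sinh.continuousOn
      differentiable_sinh.differentiableOn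
    · simpa using differentiable_cosh.differentiableOn
    · intro y hy
      simp only [interior_Ici, Set.mem_Ioi] at hy
      simpa using hy.le
  have hsinh : sinh (|t| * |x / 2|) ≤ |t| * sinh |x / 2| := by
    have := hconv.2 (Set.mem_Ici.2 (abs_nonneg (x / 2))) (Set.mem_Ici.2 (le_refl (0 : ℝ)))
      (abs_nonneg t) (sub_nonneg.2 ht) (by ring)
    simpa using this
  have hhalf (y : ℝ) : cosh y - 1 = 2 * sinh |y / 2| ^ 2 := by
    rw [← abs_sinh, sq_abs]
    have h1 := cosh_two_mul (y / 2)
    have h2 := cosh_sq (y / 2)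
    rw [mul_div_cancel₀ y two_ne_zero] at h1
    linarith
  have h0 : 0 ≤ sinh (|t| * |x / 2|) := sinh_nonneg_iff.2 (by positivity)
  have hsq := pow_le_pow_left₀ h0 hsinh 2
  rw [mul_pow, sq_abs] at hsq
  rw [hhalf, hhalf, mul_div_assoc, abs_mul]
  linarith

lemma cosh_sub_one_le_of_abs_le_half {x : ℝ} (hx : |x| ≤ 1 / 2) :
    cosh x - 1 ≤ 4 / 7 * x ^ 2 := by
  have h1 : cosh (1 / 2 : ℝ) ≤ 8 / 7 := by
    refine (cosh_le_exp_half_sq _).trans ?_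
    have := add_one_le_exp (-(1 / 8 : ℝ))
    have h2 : exp ((1 / 2 : ℝ) ^ 2 / 2) = (exp (-(1 / 8 : ℝ)))⁻¹ := by
      rw [← exp_neg]; norm_num
    rw [h2]
    refine (inv_anti₀ (by norm_num) (show (7 / 8 : ℝ) ≤ _ by linarith)).trans (by norm_num)
  have h2 := cosh_mul_sub_one_le (t := 2 * x) (by rw [abs_mul, abs_two]; linarith) (1 / 2)
  rw [show 2 * x * (1 / 2) = x by ring] at h2
  nlinarith [sq_nonneg x]

/-- The value `±1` of a sign bit. -/
def boolSign (b : Bool) : ℝ := if b then 1 else -1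

@[simp] lemma boolSign_true : boolSign true = 1 := rfl

@[simp] lemma boolSign_false : boolSign false = -1 := by simp [boolSign]

lemma sqNorm_update_add {n : ℕ} (w : Fin n → ℝ) (i : Fin n) (x : ℝ) :
    sqNorm (Function.update w i (w i + x)) = sqNorm w + 2 * x * w i + x ^ 2 := by
  unfold sqNorm
  rw [← add_sum_erase univ _ (mem_univ i), ← add_sum_erase univ (fun k => w k ^ 2) (mem_univ i),
    sum_congr rfl (g := fun k => w k ^ 2)]
  · simp; ring
  · intro k hk
    rw [Function.update_of_ne (ne_of_mem_erase hk)]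

/-- One step of feature hashing multiplies the sum of the values `cosh (μ * w k)` by at most
`exp (B * x ^ 2)` on average. -/
lemma sum_sum_cosh_update_le {n : ℕ} (w : Fin n → ℝ) {μ B x : ℝ}
    (hB : cosh (μ * x) - 1 ≤ B * n * x ^ 2) :
    ∑ a : Fin n × Bool, ∑ k, cosh (μ * Function.update w a.1 (w a.1 + boolSign a.2 * x) k) ≤
      2 * n * (exp (B * x ^ 2) * ∑ k, cosh (μ * w k)) := by
  rw [sum_comm, mul_sum, mul_sum]
  refine sum_le_sum fun k _ => ?_
  have hi (i : Fin n) :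
      ∑ b, cosh (μ * Function.update w i (w i + boolSign b * x) k) =
        2 * cosh (μ * w k) + if i = k then 2 * cosh (μ * w k) * (cosh (μ * x) - 1) else 0 := by
    split_ifs with h
    · subst h
      simp only [boolSign_true, boolSign_false, Fintype.sum_bool, Function.update_self, mul_add, cosh_add]
      simp
      ring
    · simp [Function.update_of_ne (Ne.symm h)]
  simp only [Fintype.sum_prod_type, hi, sum_add_distrib, sum_const, card_univ, Fintype.card_fin,
    nsmul_eq_mul, sum_ite_eq', mem_univ, if_true]
  have h1 := add_one_le_exp (B * x ^ 2)
  have h2 := cosh_pos (μ * w k)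
  have h3 : (n : ℝ) + (cosh (μ * x) - 1) ≤ n * exp (B * x ^ 2) := by
    nlinarith [(Nat.cast_nonneg n : (0 : ℝ) ≤ n)]
  nlinarith [mul_le_mul_of_nonneg_left h3 h2.le]

/-- One step of feature hashing multiplies `cosh (lam * s)`, where `s` is the deviation of the
squared norm from its mean, by at most `exp (A * x ^ 2)` on average. -/
lemma sum_cosh_sqNorm_update_le {n : ℕ} (w : Fin n → ℝ) {lam A K x t : ℝ} (hK : 0 ≤ K)
    (hA : 8 * lam ^ 2 * K ≤ A * n) (hw : sqNorm w ≤ 2)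
    (hcosh : ∀ i, cosh (2 * lam * x * w i) - 1 ≤ K * (2 * lam * x * w i) ^ 2) :
    ∑ a : Fin n × Bool,
        cosh (lam * (sqNorm (Function.update w a.1 (w a.1 + boolSign a.2 * x)) + t - 1)) ≤
      2 * n * (exp (A * x ^ 2) * cosh (lam * (sqNorm w + (x ^ 2 + t) - 1))) := by
  have hi (i : Fin n) :
      ∑ b, cosh (lam * (sqNorm (Function.update w i (w i + boolSign b * x)) + t - 1)) =
        2 * cosh (lam * (sqNorm w + (x ^ 2 + t) - 1)) * cosh (2 * lam * x * w i) := by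
    simp only [sqNorm_update_add, boolSign_true, boolSign_false, Fintype.sum_bool]
    have e1 : lam * (sqNorm w + 2 * (1 * x) * w i + (1 * x) ^ 2 + t - 1) =
        lam * (sqNorm w + (x ^ 2 + t) - 1) + 2 * lam * x * w i := by ring
    have e2 : lam * (sqNorm w + 2 * (-1 * x) * w i + (-1 * x) ^ 2 + t - 1) =
        lam * (sqNorm w + (x ^ 2 + t) - 1) - 2 * lam * x * w i := by ring
    rw [e1, e2, cosh_add, cosh_sub]
    ring
  have hsum : ∑ i, cosh (2 * lam * x * w i) ≤ n * exp (A * x ^ 2) := by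
    calc ∑ i, cosh (2 * lam * x * w i)
        ≤ ∑ i, (1 + K * (2 * lam * x) ^ 2 * w i ^ 2) :=
          sum_le_sum fun i _ => by linarith [hcosh i, mul_pow (2 * lam * x) (w i) 2]
      _ = n + K * (2 * lam * x) ^ 2 * sqNorm w := by
          simp [sum_add_distrib, ← mul_sum, sqNorm]
      _ ≤ n + K * (2 * lam * x) ^ 2 * 2 := by gcongr
      _ = n + 8 * lam ^ 2 * K * x ^ 2 := by ring
      _ ≤ n + A * n * x ^ 2 := by gcongr
      _ = n * (A * x ^ 2 + 1) := by ring
      _ ≤ n * exp (A * x ^ 2) := by gcongr; exact add_one_le_exp _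
  simp only [Fintype.sum_prod_type, hi, ← mul_sum]
  have := mul_le_mul_of_nonneg_left hsum (cosh_pos (lam * (sqNorm w + (x ^ 2 + t) - 1))).le
  linarith

/-- The potential function dominating the failure probability of feature hashing from the state
`w` when the remaining coordinates have squared norm `r`. -/
def hashPotential {n : ℕ} (ε lam A m μ B : ℝ) (w : Fin n → ℝ) (r : ℝ) : ℝ :=
  2 * exp (A * r - lam * ε) * cosh (lam * (sqNorm w + r - 1)) +
    2 * exp (B * r - μ * m) * ∑ k, cosh (μ * w k)

lemma hashPotential_nonneg {n : ℕ} (ε lam A m μ B : ℝ) (w : Fin n → ℝ) (r : ℝ) :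
    0 ≤ hashPotential ε lam A m μ B w r := by
  have h1 := cosh_pos (lam * (sqNorm w + r - 1))
  have h2 : 0 ≤ ∑ k, cosh (μ * w k) := sum_nonneg fun k _ => (cosh_pos _).le
  unfold hashPotential
  positivity

lemma one_le_two_exp_mul_cosh {a b c x : ℝ} (hc : 0 ≤ c) (ha : 0 ≤ a) (hx : b ≤ |x|) :
    1 ≤ 2 * exp (a - c * b) * cosh (c * x) := by
  have h1 : exp (c * b) ≤ 2 * cosh (c * x) := by
    rw [← cosh_abs, abs_mul, abs_of_nonneg hc]
    have : exp (c * b) ≤ exp (c * |x|) := by gcongr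
    rw [cosh_eq]
    linarith [exp_pos (-(c * |x|))]
  have h2 : 1 ≤ exp (a - c * b) * exp (c * b) := by
    rw [← exp_add]
    exact one_le_exp (by linarith)
  nlinarith [exp_pos (a - c * b)]

lemma one_le_hashPotential {n : ℕ} {ε lam A m μ B : ℝ} {w : Fin n → ℝ} {r : ℝ}
    (hlam : 0 ≤ lam) (hμ : 0 ≤ μ) (hA : 0 ≤ A) (hB : 0 ≤ B) (hr : 0 ≤ r)
    (hbad : ε ≤ |sqNorm w + r - 1| ∨ ∃ k, m ≤ |w k|) :
    1 ≤ hashPotential ε lam A m μ B w r := by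
  have h1 := cosh_pos (lam * (sqNorm w + r - 1))
  have h2 : 0 ≤ ∑ k, cosh (μ * w k) := sum_nonneg fun k _ => (cosh_pos _).le
  unfold hashPotential
  rcases hbad with h | ⟨k, hk⟩
  · have h3 := one_le_two_exp_mul_cosh hlam (mul_nonneg hA hr) h
    have h4 : 0 ≤ 2 * exp (B * r - μ * m) * ∑ k, cosh (μ * w k) := by positivity
    linarith
  · have h3 := one_le_two_exp_mul_cosh hμ (mul_nonneg hB hr) hk
    have h4 : cosh (μ * w k) ≤ ∑ k, cosh (μ * w k) :=
      single_le_sum (f := fun k => cosh (μ * w k)) (fun k _ => (cosh_pos _).le) (mem_univ k)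
    have h5 := mul_le_mul_of_nonneg_left h4 (by positivity : 0 ≤ 2 * exp (B * r - μ * m))
    have h6 : 0 ≤ 2 * exp (A * r - lam * ε) * cosh (lam * (sqNorm w + r - 1)) := by positivity
    linarith

/-- The state reached from `w` by hashing the vector `v` along the choices `f`. -/
def hashFrom {d n : ℕ} (w : Fin n → ℝ) (v : Fin d → ℝ) (f : Fin d → Fin n × Bool) : Fin n → ℝ :=
  fun i => w i + ∑ j, if (f j).1 = i then boolSign (f j).2 * v j else 0

lemma hashFrom_cons {d n : ℕ} (w : Fin n → ℝ) (v : Fin (d + 1) → ℝ) (a : Fin n × Bool)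
    (f : Fin d → Fin n × Bool) :
    hashFrom w v (Fin.cons a f) =
      hashFrom (Function.update w a.1 (w a.1 + boolSign a.2 * v 0)) (fun j => v j.succ) f := by
  funext i
  simp only [hashFrom, Fin.sum_univ_succ, Fin.cons_zero, Fin.cons_succ, ← add_assoc]
  congr 1
  by_cases h : a.1 = i
  · subst h; simp
  · simp [h, Function.update_of_ne (Ne.symm h)]

/-- While the state is good, the potential is a supermartingale. -/
lemma sum_hashPotential_update_le {n : ℕ} {ε lam A m μ B K x r : ℝ} {w : Fin n → ℝ} (hK : 0 ≤ K)
    (hA : 8 * lam ^ 2 * K ≤ A * n) (hw : sqNorm w ≤ 2)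
    (hcosh : ∀ i, cosh (2 * lam * x * w i) - 1 ≤ K * (2 * lam * x * w i) ^ 2)
    (hB : cosh (μ * x) - 1 ≤ B * n * x ^ 2) :
    ∑ a : Fin n × Bool,
        hashPotential ε lam A m μ B (Function.update w a.1 (w a.1 + boolSign a.2 * x)) r ≤
      2 * n * hashPotential ε lam A m μ B w (x ^ 2 + r) := by
  have h1 := mul_le_mul_of_nonneg_left (sum_cosh_sqNorm_update_le w (t := r) hK hA hw hcosh)
    (by positivity : 0 ≤ 2 * exp (A * r - lam * ε))
  have h2 := mul_le_mul_of_nonneg_left (sum_sum_cosh_update_le w hB)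
    (by positivity : 0 ≤ 2 * exp (B * r - μ * m))
  have e1 : exp (A * (x ^ 2 + r) - lam * ε) = exp (A * x ^ 2) * exp (A * r - lam * ε) := by
    rw [← exp_add]; ring_nf
  have e2 : exp (B * (x ^ 2 + r) - μ * m) = exp (B * x ^ 2) * exp (B * r - μ * m) := by
    rw [← exp_add]; ring_nf
  simp only [hashPotential, sum_add_distrib, ← mul_sum, e1, e2]
  linarith

/-- The number of choices for which the hashed vector deviates by at least `ε` is controlled by
the potential of the initial state. -/
lemma card_deviation_le_hashPotential {n : ℕ} {ε lam A m μ B K β : ℝ}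
    (hε : ε ≤ 1) (hlam : 0 ≤ lam) (hμ : 0 ≤ μ) (hA0 : 0 ≤ A) (hB0 : 0 ≤ B) (hK : 0 ≤ K)
    (hβ : 0 ≤ β) (hA : 8 * lam ^ 2 * K ≤ A * n)
    (hcosh : ∀ y, |y| ≤ 2 * lam * β * m → cosh y - 1 ≤ K * y ^ 2)
    (hB : ∀ x, |x| ≤ β → cosh (μ * x) - 1 ≤ B * n * x ^ 2)
    (d : ℕ) (v : Fin d → ℝ) (hv : ∀ j, |v j| ≤ β) (w : Fin n → ℝ) :
    ∑ f : Fin d → Fin n × Bool, (if ε ≤ |sqNorm (hashFrom w v f) - 1| then (1 : ℝ) else 0) ≤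
      (2 * n) ^ d * hashPotential ε lam A m μ B w (∑ j, v j ^ 2) := by
  induction d generalizing w with
  | zero =>
    have hw (f : Fin 0 → Fin n × Bool) : hashFrom w v f = w := by
      funext i; simp [hashFrom]
    simp only [hw, univ_unique, sum_singleton, pow_zero, one_mul]
    split_ifs with h
    · exact one_le_hashPotential hlam hμ hA0 hB0 (by simp) (Or.inl (by simpa using h))
    · exact hashPotential_nonneg ..
  | succ d ih =>
    have hr : 0 ≤ ∑ j, v j ^ 2 := sum_nonneg fun j _ => sq_nonneg _
    by_cases hbad : ε ≤ |sqNorm w + (∑ j, v j ^ 2) - 1| ∨ ∃ k, m ≤ |w k|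
    · have h1 := one_le_hashPotential hlam hμ hA0 hB0 hr hbad
      calc _ ≤ ∑ f : Fin (d + 1) → Fin n × Bool, (1 : ℝ) :=
            sum_le_sum fun f _ => by split_ifs <;> norm_num
        _ = (2 * n) ^ (d + 1) * 1 := by
            simp [mul_comm]
        _ ≤ _ := by gcongr
    · push Not at hbad
      obtain ⟨hs, hm⟩ := hbad
      have hw2 : sqNorm w ≤ 2 := by linarith [(abs_lt.1 hs).2]
      have hstep := sum_hashPotential_update_le (ε := ε) (m := m) (r := ∑ j : Fin d, v j.succ ^ 2)
        hK hA hw2 (x := v 0) (fun i => hcosh _ ?_) (hB _ (hv 0))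
      · rw [← (Fin.consEquiv fun _ => Fin n × Bool).sum_comp, Fintype.sum_prod_type,
          Fin.sum_univ_succ]
        calc _ = ∑ a : Fin n × Bool, ∑ f : Fin d → Fin n × Bool,
              (if ε ≤ |sqNorm (hashFrom (Function.update w a.1 (w a.1 + boolSign a.2 * v 0))
                (fun j => v j.succ) f) - 1| then (1 : ℝ) else 0) := by
              simp only [Fin.consEquiv, Equiv.coe_fn_mk, hashFrom_cons]
          _ ≤ ∑ a : Fin n × Bool, (2 * n) ^ d * hashPotential ε lam A m μ B
                (Function.update w a.1 (w a.1 + boolSign a.2 * v 0)) (∑ j : Fin d, v j.succ ^ 2) :=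
              sum_le_sum fun a _ => ih _ (fun j => hv _) _
          _ ≤ (2 * n) ^ d * (2 * n * hashPotential ε lam A m μ B w
                (v 0 ^ 2 + ∑ j : Fin d, v j.succ ^ 2)) := by
              rw [← mul_sum]
              gcongr
          _ = _ := by ring
      · rw [abs_mul, abs_mul, abs_of_nonneg (by positivity : 0 ≤ 2 * lam)]
        have := hv 0
        have := (hm i).le
        gcongr

lemma hashFrom_zero_eq_prefixVec {d d' : ℕ} (v : Fin d → ℝ) (ω : HashOmega d d') :
    hashFrom 0 v (fun j => (ω.1 j, ω.2 j)) = prefixVec d' v d ω := by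
  funext i
  simp [hashFrom, prefixVec, hashSgn, boolSign, sum_filter]

/-- A counting bound on the complement bounds the uniform probability from below. -/
lemma ofReal_one_sub_le_hashUnif {d d' : ℕ} [NeZero d'] (p : HashOmega d d' → Prop)
    [DecidablePred p] {c : ℝ}
    (h : ∑ ω, (if p ω then (1 : ℝ) else 0) ≤ (2 * d') ^ d * c) :
    ENNReal.ofReal (1 - c) ≤ hashUnif d d' {ω | ¬ p ω} := by
  have hd' : (0 : ℝ) < d' := Nat.cast_pos.2 (NeZero.pos d')
  have hN : (0 : ℝ) < (2 * d') ^ d := by positivity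
  have hcard : (Fintype.card (HashOmega d d') : ℝ) = (2 * d') ^ d := by
    simp [HashOmega, mul_pow, mul_comm]
  have hsplit := Finset.card_filter_add_card_filter_not (s := (univ : Finset (HashOmega d d'))) p
  rw [card_univ] at hsplit
  have hsplit' : (#{ω : HashOmega d d' | p ω} : ℝ) + #{ω : HashOmega d d' | ¬ p ω} =
      (2 * d') ^ d := by
    rw [← hcard]; exact_mod_cast hsplit
  rw [sum_boole] at h
  rw [hashUnif, PMF.toMeasure_uniformOfFintype_apply _ (Set.toFinite _).measurableSet]
  have hc2 : Fintype.card {ω : HashOmega d d' | ¬ p ω} = #{ω : HashOmega d d' | ¬ p ω} := by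
    exact Fintype.card_subtype _
  rw [hc2, ← ENNReal.ofReal_natCast, ← ENNReal.ofReal_natCast, hcard,
    ← ENNReal.ofReal_div_of_pos hN]
  apply ENNReal.ofReal_le_ofReal
  rw [le_div_iff₀ hN]
  linarith

/-- **Feature hashing with truly random hash functions (main theorem).**
If `‖v‖₂ = 1`, `d' ≥ α = 16 ε⁻² log₂(1/δ)` and
`‖v‖_∞ ≤ β = √(ε·log(1+4/ε)) / (6·√(log(1/δ)·log(d'/δ)))`, then the feature-hashed
vector `v'` satisfies `Pr[1 − ε < ‖v'‖₂² < 1 + ε] ≥ 1 − 4δ`. -/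
theorem feature_hashing_concentration
    (d d' : ℕ) [NeZero d] [NeZero d'] (v : Fin d → ℝ)
    (hv : ∑ j, (v j) ^ 2 = 1)
    (ε δ : ℝ) (hε : ε ∈ Set.Ioo (0 : ℝ) 1) (hδ : δ ∈ Set.Ioo (0 : ℝ) 1)
    (α β : ℝ)
    (hα : α = 16 / ε ^ 2 * Real.logb 2 (1 / δ))
    (hβ : β = Real.sqrt (ε * Real.log (1 + 4 / ε)) /
      (6 * Real.sqrt (Real.log (1 / δ) * Real.log ((d' : ℝ) / δ))))
    (hd' : α ≤ (d' : ℝ))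
    (hvinf : ∀ j, |v j| ≤ β) :
    ENNReal.ofReal (1 - 4 * δ) ≤
      hashUnif d d' {ω |
        1 - ε < sqNorm (prefixVec d' v d ω) ∧ sqNorm (prefixVec d' v d ω) < 1 + ε} := by
  obtain ⟨hε0, hε1⟩ := hε
  obtain ⟨hδ0, hδ1⟩ := hδ
  have hn : (1 : ℝ) ≤ d' := by exact_mod_cast NeZero.one_le
  have hn0 : (0 : ℝ) < d' := by linarith
  set L := log (1 / δ) with hL
  set l := log ((d' : ℝ) / δ) with hl
  set u := log (1 + 4 / ε) with hu
  have hL0 : 0 < L := log_pos (by rw [lt_div_iff₀ hδ0]; linarith)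
  have hl0 : 0 < l := log_pos (by rw [lt_div_iff₀ hδ0]; linarith)
  have h4 : 4 ≤ 4 / ε := by rw [le_div_iff₀ hε0]; linarith
  have hu1 : 1 ≤ u := by
    rw [hu, le_log_iff_exp_le (by linarith)]
    linarith [exp_one_lt_d9]
  have hβ0 : 0 < β := by
    rw [hβ]
    have : 0 < u := by linarith
    positivity
  have hβsq : l * β ^ 2 = ε * u / (36 * L) := by
    rw [hβ, div_pow, mul_pow, sq_sqrt (by positivity), sq_sqrt (by positivity)]
    field_simp
    norm_num
  have hlog2 : log 2 < 0.7 := by linarith [log_two_lt_d9]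
  have hlog20 : 0 < log 2 := log_pos (by norm_num)
  have hdim : 16 * L ≤ 0.7 * (d' * ε ^ 2) := by
    rw [hα, logb, ← hL, div_mul_div_comm, div_le_iff₀ (by positivity)] at hd'
    nlinarith [mul_le_mul_of_nonneg_left hlog2.le (by positivity : 0 ≤ d' * ε ^ 2)]
  have hcoshu : cosh u - 1 ≤ 2 / ε := by
    have h1 : exp u = 1 + 4 / ε := exp_log (by linarith)
    have h2 : exp (-u) ≤ 1 := exp_le_one_iff.2 (by linarith)
    rw [cosh_eq, h1]
    have : 4 / ε = 2 * (2 / ε) := by ring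
    linarith
  have hcosh1 : 0 ≤ cosh u - 1 := sub_nonneg.2 (one_le_cosh u)
  set lam := 2 * L / ε with hlam
  set m := ε / (8 * L * β) with hm
  set μ := u / β with hμ
  set A := 8 * lam ^ 2 * (4 / 7) / d' with hA
  set B := (cosh u - 1) / (d' * β ^ 2) with hB
  have hcount := card_deviation_le_hashPotential (n := d') (ε := ε) (lam := lam) (A := A) (m := m)
    (μ := μ) (B := B) (K := 4 / 7) (β := β) hε1.le (by positivity) (by positivity) (by positivity)
    (by positivity) (by norm_num) hβ0.le (by rw [hA]; field_simp; rfl)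
    (fun y hy => cosh_sub_one_le_of_abs_le_half (hy.trans (by
      rw [hlam, hm]; apply le_of_eq; field_simp; norm_num)))
    (fun x hx => by
      have h := cosh_mul_sub_one_le (t := x / β)
        (by rw [abs_div, abs_of_pos hβ0]; exact div_le_one_of_le₀ hx hβ0.le) u
      rw [show μ * x = x / β * u by rw [hμ]; ring]
      refine h.trans (le_of_eq ?_)
      rw [hB]
      field_simp)
    d v hvinf 0
  have hAle : A - lam * ε ≤ -L := by
    have : A ≤ L := by
      rw [hA, hlam, div_le_iff₀ hn0]
      field_simp
      nlinarith
    have h2 : lam * ε = 2 * L := by rw [hlam]; field_simp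
    linarith
  have hBle : B - μ * m ≤ -l := by
    have h1 : B * β ^ 2 ≤ 0.7 / 8 * (ε / L) := by
      calc B * β ^ 2 = (cosh u - 1) / d' := by rw [hB]; field_simp
        _ ≤ (2 / ε) / d' := by gcongr
        _ ≤ 0.7 / 8 * (ε / L) := by
          rw [div_div, ← mul_div_assoc, div_le_div_iff₀ (by positivity) hL0]
          linarith
    have h2 : μ * m * β ^ 2 = u / 8 * (ε / L) := by rw [hμ, hm]; field_simp
    have h3 : l * β ^ 2 = u / 36 * (ε / L) := by rw [hβsq]; field_simp
    have h4 : 0 < ε / L := by positivity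
    have h5 : (B - μ * m + l) * β ^ 2 ≤ 0 := by
      rw [add_mul, sub_mul, h2, h3]
      nlinarith
    have h6 : 0 < β ^ 2 := by positivity
    by_contra! h7
    nlinarith
  have hpot : hashPotential ε lam A m μ B (0 : Fin d' → ℝ) (∑ j, v j ^ 2) ≤ 4 * δ := by
    have e1 : exp (A - lam * ε) ≤ δ := by
      refine (exp_le_exp.2 hAle).trans (le_of_eq ?_)
      rw [hL, ← log_inv, exp_log (by positivity)]
      simp
    have e2 : exp (B - μ * m) ≤ δ / d' := by
      refine (exp_le_exp.2 hBle).trans (le_of_eq ?_)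
      rw [hl, ← log_inv, exp_log (by positivity), inv_div]
    rw [le_div_iff₀ hn0] at e2
    simp only [hashPotential, hv, sqNorm, Pi.zero_apply, mul_one, mul_zero, cosh_zero, sum_const,
      card_univ, Fintype.card_fin, nsmul_eq_mul]
    simp
    linarith
  have hcount' : ∑ ω : HashOmega d d',
      (if ε ≤ |sqNorm (prefixVec d' v d ω) - 1| then (1 : ℝ) else 0) ≤
        (2 * d') ^ d * (4 * δ) := by
    rw [← (Equiv.arrowProdEquivProdArrow (Fin d) (fun _ => Fin d') (fun _ => Bool)).sum_comp]
    simp only [← hashFrom_zero_eq_prefixVec]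
    exact hcount.trans (by gcongr)
  refine (ofReal_one_sub_le_hashUnif _ hcount').trans (measure_mono fun ω hω => ?_)
  simp only [Set.mem_ofPred_eq, not_le, abs_lt] at hω ⊢
  constructor <;> linarith [hω.1, hω.2]

end
end

section
/- Let d and d' be positive integers, v ∈ ℝ^d, and let h : [d] → [d'] and sgn : [d] → {−1,+1} be independent uniformly random functions. For k = 0,…,d define the prefix vector v'^{(k)} ∈ ℝ^{d'} by v'^{(k)}_i = Σ_{j ≤ k, h(j) = i} sgn(j)·v_j, and set X_k = ‖v'^{(k)}‖₂² − ‖v'^{(k−1)}‖₂² − v_k². Then for every k = 1,…,d, E[X_k | X₁,…,X_{k−1}] = 0. -/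
open MeasureTheory ProbabilityTheory Real Finset

noncomputable section

/-- The martingale increments `X_k = ‖v'^{(k)}‖₂² − ‖v'^{(k−1)}‖₂² − v_k²`
(with `k` 1-indexed in the paper, so `Xinc d' v j` for `j : Fin d` is `X_{j+1}`). -/
def Xinc {d : ℕ} (d' : ℕ) (v : Fin d → ℝ) (j : Fin d) (ω : HashOmega d d') : ℝ :=
  sqNorm (prefixVec d' v ((j : ℕ) + 1) ω) - sqNorm (prefixVec d' v (j : ℕ) ω) - (v j) ^ 2

/-- The σ-algebra generated by `X₁, …, X_{k−1}`, i.e. by the increments `Xinc d' v i`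
for `i < j`. -/
def XFilt {d : ℕ} (d' : ℕ) (v : Fin d → ℝ) (j : Fin d) : MeasurableSpace (HashOmega d d') :=
  ⨆ (i : Fin d) (_ : i < j), MeasurableSpace.comap (Xinc d' v i) inferInstance

/-- Flip the sign bit of coordinate `j`. -/
def flipSgn {d d' : ℕ} (j : Fin d) (ω : HashOmega d d') : HashOmega d d' :=
  (ω.1, Function.update ω.2 j (!ω.2 j))

lemma flipSgn_involutive {d d' : ℕ} (j : Fin d) :
    Function.Involutive (flipSgn (d' := d') j) := fun ω => by
  simp [flipSgn]

lemma hashSgn_flipSgn_self {d d' : ℕ} (j : Fin d) (ω : HashOmega d d') :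
    hashSgn (flipSgn j ω) j = -hashSgn ω j := by
  cases h : ω.2 j <;> simp [hashSgn, flipSgn, h]

lemma hashSgn_flipSgn_of_ne {d d' : ℕ} {i j : Fin d} (hij : i ≠ j) (ω : HashOmega d d') :
    hashSgn (flipSgn j ω) i = hashSgn ω i := by
  simp [hashSgn, flipSgn, hij]

lemma hashSgn_sq {d d' : ℕ} (j : Fin d) (ω : HashOmega d d') : hashSgn ω j ^ 2 = 1 := by
  unfold hashSgn; split_ifs <;> norm_num

lemma prefixVec_flipSgn {d d' : ℕ} (v : Fin d → ℝ) {k : ℕ} {j : Fin d} (hk : k ≤ j)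
    (ω : HashOmega d d') : prefixVec d' v k (flipSgn j ω) = prefixVec d' v k ω := by
  funext i
  refine Finset.sum_congr rfl fun l hl => ?_
  have hlj : l ≠ j := by
    rintro rfl
    have := (Finset.mem_filter.mp hl).2.1
    omega
  rw [hashSgn_flipSgn_of_ne hlj]

lemma prefixVec_succ {d d' : ℕ} (v : Fin d → ℝ) (j : Fin d) (ω : HashOmega d d')
    (i : Fin d') : prefixVec d' v (j + 1) ω i =
      prefixVec d' v j ω i + if ω.1 j = i then hashSgn ω j * v j else 0 := by
  simp only [prefixVec, Finset.sum_filter]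
  rw [← Finset.add_sum_erase _ _ (Finset.mem_univ j),
    ← Finset.add_sum_erase (a := j) _ (fun l : Fin d =>
      if (l : ℕ) < j ∧ ω.1 l = i then hashSgn ω l * v l else 0) (Finset.mem_univ j)]
  have hsum : ∀ l ∈ Finset.univ.erase j,
      (if (l : ℕ) < j + 1 ∧ ω.1 l = i then hashSgn ω l * v l else 0) =
        if (l : ℕ) < j ∧ ω.1 l = i then hashSgn ω l * v l else 0 := fun l hl => by
    have hlj : (l : ℕ) ≠ j := fun h => Finset.ne_of_mem_erase hl (Fin.ext h)
    have hiff : (l : ℕ) < j + 1 ↔ (l : ℕ) < j := by omega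
    simp only [hiff]
  rw [Finset.sum_congr rfl hsum]
  simp [add_comm]

lemma Xinc_eq {d d' : ℕ} (v : Fin d → ℝ) (j : Fin d) (ω : HashOmega d d') :
    Xinc d' v j ω = 2 * prefixVec d' v j ω (ω.1 j) * (hashSgn ω j * v j) := by
  have hterm : ∀ i, prefixVec d' v (j + 1) ω i ^ 2 = prefixVec d' v j ω i ^ 2 +
      if ω.1 j = i then
        2 * prefixVec d' v j ω i * (hashSgn ω j * v j) + v j ^ 2 else 0 := fun i => by
    rw [prefixVec_succ]
    split_ifs
    · linear_combination v j ^ 2 * hashSgn_sq j ω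
    · ring
  simp only [Xinc, sqNorm, hterm, Finset.sum_add_distrib, Finset.sum_ite_eq,
    Finset.mem_univ, if_true]
  ring

lemma Xinc_flipSgn_self {d d' : ℕ} (v : Fin d → ℝ) (j : Fin d) (ω : HashOmega d d') :
    Xinc d' v j (flipSgn j ω) = -Xinc d' v j ω := by
  rw [Xinc_eq, Xinc_eq, prefixVec_flipSgn v le_rfl, hashSgn_flipSgn_self]
  simp only [flipSgn]
  ring

lemma Xinc_flipSgn_of_lt {d d' : ℕ} (v : Fin d → ℝ) {i j : Fin d} (hij : i < j)
    (ω : HashOmega d d') : Xinc d' v i (flipSgn j ω) = Xinc d' v i ω := by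
  have h : (i : ℕ) < j := hij
  rw [Xinc, Xinc, prefixVec_flipSgn v h, prefixVec_flipSgn v h.le]

lemma XFilt_le_invariants {d : ℕ} (d' : ℕ) (v : Fin d → ℝ) (j : Fin d) :
    XFilt d' v j ≤ MeasurableSpace.invariants (flipSgn j) := by
  refine iSup₂_le fun i hij => ?_
  rintro _ ⟨t, -, rfl⟩
  refine MeasurableSpace.measurableSet_invariants.mpr ⟨(Set.toFinite _).measurableSet, ?_⟩
  ext ω
  simp [Xinc_flipSgn_of_lt v hij]

instance isProbabilityMeasure_hashUnif (d d' : ℕ) [NeZero d'] :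
    IsProbabilityMeasure (hashUnif d d') :=
  PMF.toMeasure.isProbabilityMeasure _

lemma measurePreserving_flipSgn {d d' : ℕ} [NeZero d'] (j : Fin d) :
    MeasurePreserving (flipSgn j) (hashUnif d d') (hashUnif d d') := by
  refine ⟨measurable_of_finite _, Measure.ext_of_singleton fun ω => ?_⟩
  have hpre : flipSgn j ⁻¹' {ω} = {flipSgn j ω} := by
    ext η
    simp [(flipSgn_involutive j).eq_iff]
  rw [Measure.map_apply (measurable_of_finite _) (measurableSet_singleton _), hpre]
  simp [hashUnif]

lemma setIntegral_Xinc_eq_zero {d d' : ℕ} [NeZero d'] (v : Fin d → ℝ) (j : Fin d)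
    {s : Set (HashOmega d d')} (hs : MeasurableSet[XFilt d' v j] s) :
    ∫ ω in s, Xinc d' v j ω ∂hashUnif d d' = 0 := by
  obtain ⟨-, hinv⟩ := MeasurableSpace.measurableSet_invariants.mp (XFilt_le_invariants d' v j s hs)
  have hemb : MeasurableEmbedding (flipSgn (d' := d') j) :=
    (MeasurableEquiv.mk (flipSgn_involutive j).toPerm (measurable_of_finite _)
      (measurable_of_finite _)).measurableEmbedding
  have h := (measurePreserving_flipSgn (d' := d') j).setIntegral_preimage_emb hemb
    (Xinc d' v j) s
  simp only [hinv, Xinc_flipSgn_self, integral_neg] at h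
  linarith

/-- **Martingale-difference property of the feature hashing increments.**
With `h`, `sgn` independent uniformly random and `X_k = ‖v'^{(k)}‖₂² − ‖v'^{(k−1)}‖₂² − v_k²`,
we have `E[X_k | X₁,…,X_{k−1}] = 0` for every `k = 1,…,d`. -/
theorem Xinc_condexp_zero
    (d d' : ℕ) [NeZero d] [NeZero d'] (v : Fin d → ℝ) (j : Fin d) :
    (hashUnif d d')[Xinc d' v j | XFilt d' v j] =ᵐ[hashUnif d d'] 0 := by
  refine (ae_eq_condExp_of_forall_setIntegral_eq
    ((XFilt_le_invariants d' v j).trans (MeasurableSpace.invariants_le _))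
    .of_finite (fun _ _ _ => integrableOn_zero) (fun s hs _ => ?_)
    aestronglyMeasurable_zero).symm
  simpa using (setIntegral_Xinc_eq_zero v j hs).symm

end
end

section
/- Let d and d' be positive integers, let v ∈ ℝ^d with ‖v‖₂ = 1, let ε ∈ (0,1], and let h : [d] → [d'] and sgn : [d] → {−1,+1} be any functions. Define v'^{(k)} ∈ ℝ^{d'} by v'^{(k)}_i = Σ_{j ≤ k, h(j) = i} sgn(j)·v_j, X_k = ‖v'^{(k)}‖₂² − ‖v'^{(k−1)}‖₂² − v_k², X_{≤k} = Σ_{i=1}^k X_i, and let V_k = Σ_{i=1}^k (4·v_i²/d')·‖v'^{(i−1)}‖₂². If |X_{≤d}| ≥ ε, then there exists k ∈ {1,…,d} with |X_{≤k}| ≥ ε and V_k ≤ 8/d'. -/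
open Real Finset

noncomputable section

/-- The prefix vector `v'^{(k)} ∈ ℝ^{d'}` of feature hashing with (arbitrary, fixed) hash
functions `h : [d] → [d']` and `s = sgn : [d] → {−1,+1}`:
`v'^{(k)}_i = ∑_{j ≤ k, h(j) = i} sgn(j)·v_j`. -/
def dPrefixVec {d : ℕ} (d' : ℕ) (h : Fin d → Fin d') (s : Fin d → ℝ) (v : Fin d → ℝ)
    (k : ℕ) : Fin d' → ℝ :=
  fun i => ∑ j ∈ univ.filter (fun j : Fin d => (j : ℕ) < k ∧ h j = i), s j * v j

/-- The increment `X_k = ‖v'^{(k)}‖₂² − ‖v'^{(k−1)}‖₂² − v_k²` (here `j : Fin d` is the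
paper's index `k = j+1`). -/
def dXinc {d : ℕ} (d' : ℕ) (h : Fin d → Fin d') (s : Fin d → ℝ) (v : Fin d → ℝ)
    (j : Fin d) : ℝ :=
  sqNorm (dPrefixVec d' h s v ((j : ℕ) + 1)) - sqNorm (dPrefixVec d' h s v (j : ℕ)) -
    (v j) ^ 2

/-- The partial sum `X_{≤k} = ∑_{i=1}^k X_i`. -/
def dXsum {d : ℕ} (d' : ℕ) (h : Fin d → Fin d') (s : Fin d → ℝ) (v : Fin d → ℝ)
    (k : ℕ) : ℝ :=
  ∑ j ∈ univ.filter (fun j : Fin d => (j : ℕ) < k), dXinc d' h s v j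

/-- The accumulated conditional variance `V_k = ∑_{i=1}^k (4·v_i²/d')·‖v'^{(i−1)}‖₂²`. -/
def dVsum {d : ℕ} (d' : ℕ) (h : Fin d → Fin d') (s : Fin d → ℝ) (v : Fin d → ℝ)
    (k : ℕ) : ℝ :=
  ∑ j ∈ univ.filter (fun j : Fin d => (j : ℕ) < k),
    4 * (v j) ^ 2 / (d' : ℝ) * sqNorm (dPrefixVec d' h s v (j : ℕ))

theorem sum_filter_val_lt_succ {d k : ℕ} (hk : k < d) (f : Fin d → ℝ) :
    ∑ j ∈ univ.filter (fun j : Fin d => (j : ℕ) < k + 1), f j =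
      ∑ j ∈ univ.filter (fun j : Fin d => (j : ℕ) < k), f j + f ⟨k, hk⟩ := by
  have hins : univ.filter (fun j : Fin d => (j : ℕ) < k + 1) =
      insert ⟨k, hk⟩ (univ.filter (fun j : Fin d => (j : ℕ) < k)) := by
    ext j
    simp only [mem_filter, mem_univ, true_and, mem_insert, Fin.ext_iff]
    omega
  rw [hins, sum_insert (by simp), add_comm]

/-- The increments telescope: `X_{≤k} = ‖v'^{(k)}‖₂² − ∑_{i ≤ k} v_i²`. -/
theorem dXsum_eq {d : ℕ} (d' : ℕ) (h : Fin d → Fin d') (s v : Fin d → ℝ) {k : ℕ} (hk : k ≤ d) :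
    dXsum d' h s v k = sqNorm (dPrefixVec d' h s v k) -
      ∑ j ∈ univ.filter (fun j : Fin d => (j : ℕ) < k), (v j) ^ 2 := by
  induction k with
  | zero => simp [dXsum, sqNorm, dPrefixVec]
  | succ k ih =>
    have hstep : dXsum d' h s v (k + 1) = dXsum d' h s v k + dXinc d' h s v ⟨k, hk⟩ :=
      sum_filter_val_lt_succ hk _
    rw [hstep, ih (Nat.le_of_succ_le hk), sum_filter_val_lt_succ hk, dXinc]
    ring

theorem dXsum_zero {d : ℕ} (d' : ℕ) (h : Fin d → Fin d') (s v : Fin d → ℝ) :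
    dXsum d' h s v 0 = 0 := by
  simp [dXsum]

/-- A uniform bound on the squared norms of the prefixes bounds the accumulated variance. -/
theorem dVsum_le {d : ℕ} (d' : ℕ) (h : Fin d → Fin d') (s v : Fin d → ℝ)
    (hv : ∑ j, (v j) ^ 2 = 1) {k : ℕ} {C : ℝ} (hC : 0 ≤ C)
    (hbound : ∀ j : Fin d, (j : ℕ) < k → sqNorm (dPrefixVec d' h s v j) ≤ C) :
    dVsum d' h s v k ≤ 4 * C / (d' : ℝ) := by
  calc dVsum d' h s v k
      ≤ ∑ j ∈ univ.filter (fun j : Fin d => (j : ℕ) < k), 4 * (v j) ^ 2 / (d' : ℝ) * C :=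
        sum_le_sum fun j hj =>
          mul_le_mul_of_nonneg_left (hbound j (mem_filter.mp hj).2) (by positivity)
    _ ≤ ∑ j, 4 * (v j) ^ 2 / (d' : ℝ) * C :=
        sum_le_sum_of_subset_of_nonneg (filter_subset _ _) fun j _ _ => by positivity
    _ = (∑ j, (v j) ^ 2) * (4 * C / (d' : ℝ)) := by
        rw [sum_mul]
        exact sum_congr rfl fun j _ => by ring
    _ = 4 * C / (d' : ℝ) := by rw [hv, one_mul]

/-- **Stopping-time reduction in the feature hashing proof.**
If `‖v‖₂ = 1`, `ε ∈ (0,1]` and `|X_{≤d}| ≥ ε`, then there is `k ∈ {1,…,d}` with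
`|X_{≤k}| ≥ ε` and `V_k ≤ 8/d'`. -/
theorem stopping_time_reduction
    (d d' : ℕ) [NeZero d] [NeZero d'] (v : Fin d → ℝ)
    (hv : ∑ j, (v j) ^ 2 = 1) (ε : ℝ) (hε : ε ∈ Set.Ioc (0 : ℝ) 1)
    (h : Fin d → Fin d') (s : Fin d → ℝ) (hs : ∀ j, s j = 1 ∨ s j = -1)
    (hbig : ε ≤ |dXsum d' h s v d|) :
    ∃ k ∈ Finset.Icc 1 d, ε ≤ |dXsum d' h s v k| ∧ dVsum d' h s v k ≤ 8 / (d' : ℝ) := by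
  classical
  have hex : ∃ k, ε ≤ |dXsum d' h s v k| := ⟨d, hbig⟩
  have hle : Nat.find hex ≤ d := Nat.find_min' hex hbig
  have hpos : 1 ≤ Nat.find hex := by
    rw [Nat.one_le_iff_ne_zero]
    intro h0
    have hfind := Nat.find_spec hex
    rw [h0, dXsum_zero, abs_zero] at hfind
    exact absurd hε.1 hfind.not_gt
  refine ⟨Nat.find hex, mem_Icc.mpr ⟨hpos, hle⟩, Nat.find_spec hex, ?_⟩
  have hbound : ∀ j : Fin d, (j : ℕ) < Nat.find hex → sqNorm (dPrefixVec d' h s v j) ≤ 2 := by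
    intro j hj
    have hsmall := (abs_lt.mp (not_le.mp (Nat.find_min hex hj))).2
    rw [dXsum_eq d' h s v j.2.le] at hsmall
    have hmass : ∑ i ∈ univ.filter (fun i : Fin d => (i : ℕ) < j), (v i) ^ 2 ≤ 1 :=
      (sum_le_sum_of_subset_of_nonneg (filter_subset _ _) fun i _ _ => sq_nonneg _).trans_eq hv
    linarith [hε.2]
  calc dVsum d' h s v (Nat.find hex) ≤ 4 * 2 / (d' : ℝ) :=
        dVsum_le d' h s v hv (by norm_num) hbound
    _ = 8 / (d' : ℝ) := by norm_num

end
end
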